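/- arXiv:0905.3775 — 3 statements merged into one kernel-verified Lean document; each statement's English description precedes it below -/
import Mathlib

section
/- Let X be a Noetherian topological space (i.e., a topological space whose closed subsets satisfy the descending chain condition) and let (x_i)_{i ∈ ℕ} be a sequence of points of X. Then there exist a closed irreducible subset Z ⊆ X and an infinite subset I ⊆ ℕ such that x_i ∈ Z for every i ∈ I and the set {x_i : i ∈ I} is dense in Z. -/
/-- In a Noetherian topological space, for every sequence of points there exist a closed
irreducible subset `Z` and an infinite set `I` of indices such that all points indexed by `I`
lie in `Z` and form a dense subset of `Z`. -/
theorem noetherian_exists_closed_irreducible_dense_of_seq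
    {X : Type*} [TopologicalSpace X] [TopologicalSpace.NoetherianSpace X] (x : ℕ → X) :
    ∃ (Z : Set X) (I : Set ℕ), IsClosed Z ∧ IsIrreducible Z ∧ I.Infinite ∧
      (∀ i ∈ I, x i ∈ Z) ∧ Z ⊆ closure (x '' I) := by
  obtain ⟨Z, hZ, hmin⟩ := exists_minimal_of_wellFoundedLT
    (fun Z : TopologicalSpace.Closeds X ↦ (x ⁻¹' (Z : Set X)).Infinite)
    ⟨⊤, by simpa using Set.infinite_univ⟩
  have subset_of_infinite {W : Set X} (hW : IsClosed W)
      (hinf : (x ⁻¹' ((Z : Set X) ∩ W)).Infinite) : (Z : Set X) ⊆ W := fun _ hz ↦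
    (hmin (y := ⟨Z ∩ W, Z.isClosed.inter hW⟩) hinf (fun _ hw ↦ hw.1) hz).2
  refine ⟨Z, x ⁻¹' Z, Z.isClosed, ⟨?_, ?_⟩, hZ, fun _ hi ↦ hi, ?_⟩
  · obtain ⟨i, hi⟩ := hZ.nonempty
    exact ⟨x i, hi⟩
  · rw [isPreirreducible_iff_isClosed_union_isClosed]
    intro W₁ W₂ hW₁ hW₂ hcover
    have hunion : (x ⁻¹' (Z ∩ W₁) ∪ x ⁻¹' (Z ∩ W₂)).Infinite := by
      rwa [← Set.preimage_union, ← Set.inter_union_distrib_left,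
        Set.inter_eq_left.mpr hcover]
    exact (Set.infinite_union.mp hunion).imp (subset_of_infinite hW₁) (subset_of_infinite hW₂)
  · exact subset_of_infinite isClosed_closure
      (hZ.mono fun i hi ↦ ⟨hi, subset_closure (Set.mem_image_of_mem x hi)⟩)
end

section
/- Let I be a finite nonempty index set, and for each i ∈ I let k_i ≥ 0, a_i > 0 and c_i > 0 be real numbers. Then there exists a real number M such that for every real number m ≥ M and every i ∈ I, the following two conditions are equivalent: (1) (k_i + 1)/(a_i + c_i/m) = min_{j ∈ I} (k_j + 1)/(a_j + c_j/m); (2) (k_i + 1)/a_i = min_{j ∈ I} (k_j + 1)/a_j, and (k_i + 1)/c_i = min { (k_j + 1)/c_j : j ∈ I and (k_j + 1)/a_j = min_{l ∈ I} (k_l + 1)/a_l }. In other words, for all sufficiently large m, the minimizers of the perturbed quantity (k_i+1)/(a_i + c_i/m) are exactly those minimizers of (k_i+1)/a_i that in addition minimize (k_i+1)/c_i among the minimizers of (k_i+1)/a_i. -/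
open Filter in
/-- For large `m`, an affine function of `m` is nonpositive exactly when its pair of coefficients
is lexicographically nonpositive. -/
theorem eventually_mul_add_nonpos_iff (A C : ℝ) :
    ∀ᶠ m : ℝ in atTop, A * m + C ≤ 0 ↔ A < 0 ∨ A = 0 ∧ C ≤ 0 := by
  rcases lt_trichotomy A 0 with hA | rfl | hA
  · have h : Tendsto (fun m : ℝ => A * m + C) atTop atBot :=
      tendsto_atBot_add_const_right _ _ (tendsto_id.const_mul_atTop_of_neg hA)
    filter_upwards [h.eventually_le_atBot 0] with m hm
    simp [hm, hA]
  · simp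
  · have h : Tendsto (fun m : ℝ => A * m + C) atTop atTop :=
      tendsto_atTop_add_const_right _ _ (tendsto_id.const_mul_atTop hA)
    filter_upwards [h.eventually_gt_atTop 0] with m hm
    simp [hm.not_ge, hA.not_gt, hA.ne']

open Filter in
/-- For large `m`, comparing `x / (a + c / m)` with `y / (b + d / m)` amounts to comparing the pairs
`(x / a, x / c)` and `(y / b, y / d)` lexicographically. -/
theorem eventually_div_add_div_le_iff (x y : ℝ) {a b c d : ℝ}
    (ha : 0 < a) (hb : 0 < b) (hc : 0 < c) (hd : 0 < d) :
    ∀ᶠ m : ℝ in atTop, x / (a + c / m) ≤ y / (b + d / m) ↔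
      x / a < y / b ∨ x / a = y / b ∧ x / c ≤ y / d := by
  filter_upwards [eventually_mul_add_nonpos_iff (x * b - y * a) (x * d - y * c),
    eventually_gt_atTop 0] with m hm hm0
  rw [div_lt_div_iff₀ ha hb, div_eq_div_iff ha.ne' hb.ne', div_le_div_iff₀ hc hd,
    div_le_div_iff₀ (by positivity) (by positivity), ← sub_neg, ← sub_eq_zero (a := x * b),
    ← sub_nonpos (a := x * d), ← hm, ← sub_nonpos, ← mul_le_mul_iff_of_pos_right hm0, zero_mul]
  have h : (x * (b + d / m) - y * (a + c / m)) * m =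
      (x * b - y * a) * m + (x * d - y * c) := by
    field_simp
    ring
  rw [h]


/-- For a finite nonempty family of real numbers `k i ≥ 0`, `a i > 0`, `c i > 0`, there is `M`
such that for all real `m ≥ M`, an index `i` minimizes `(k i + 1)/(a i + c i / m)` if and only if
it minimizes `(k i + 1)/a i` and, in addition, it minimizes `(k i + 1)/c i` among the minimizers
of `(k j + 1)/a j`. -/
theorem exists_bound_minimizers_perturbed
    {I : Type*} [Fintype I] [Nonempty I] (k a c : I → ℝ)
    (hk : ∀ i, 0 ≤ k i) (ha : ∀ i, 0 < a i) (hc : ∀ i, 0 < c i) :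
    ∃ M : ℝ, ∀ m : ℝ, M ≤ m → ∀ i : I,
      ((∀ j, (k i + 1) / (a i + c i / m) ≤ (k j + 1) / (a j + c j / m)) ↔
        ((∀ j, (k i + 1) / a i ≤ (k j + 1) / a j) ∧
          (∀ j, (∀ l, (k j + 1) / a j ≤ (k l + 1) / a l) →
            (k i + 1) / c i ≤ (k j + 1) / c j))) := by
  obtain ⟨M, hM⟩ := Filter.eventually_atTop.1 <| Filter.eventually_all.2 fun i =>
    Filter.eventually_all.2 fun j =>
      eventually_div_add_div_le_iff (k i + 1) (k j + 1) (ha i) (ha j) (hc i) (hc j)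
  refine ⟨M, fun m hm i => ?_⟩
  simp only [hM m hm]
  constructor
  · intro h
    refine ⟨fun j => (h j).elim le_of_lt fun hj => hj.1.le, fun j hj => ?_⟩
    exact ((h j).resolve_left (hj i).not_gt).2
  · rintro ⟨hmin, hsec⟩ j
    refine (hmin j).lt_or_eq.imp_right fun hj => ⟨hj, hsec j fun l => ?_⟩
    exact hj ▸ hmin l
end

section
/- Let G be a simple graph on a finite vertex set V, and let α, β : V → ℝ be functions satisfying: (a) α(v) ≤ 1 for every v ∈ V; (b) for every v ∈ V with α(v) = 1, one has β(v) = 1 and α(w) = β(w) for every vertex w adjacent to v; (c) there exists v₀ ∈ V with α(v₀) = 1; and (d) the subgraph of G induced on the set S = {v ∈ V : β(v) ≥ 1} is connected. Then β(v) ≤ 1 for every v ∈ V. -/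
/-- Let `G` be a simple graph on a finite vertex set `V` and `α β : V → ℝ` with `α ≤ 1`
everywhere, such that whenever `α v = 1` one has `β v = 1` and `α = β` on all neighbors of `v`,
there is some vertex with `α v₀ = 1`, and the subgraph induced on `{v | β v ≥ 1}` is connected.
Then `β ≤ 1` everywhere. -/
theorem beta_le_one_of_connected
    {V : Type*} [Fintype V] (G : SimpleGraph V) (α β : V → ℝ)
    (ha : ∀ v, α v ≤ 1)
    (hb : ∀ v, α v = 1 → β v = 1 ∧ ∀ w, G.Adj v w → α w = β w)
    (hc : ∃ v₀, α v₀ = 1)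
    (hd : (G.induce {v : V | 1 ≤ β v}).Connected) :
    ∀ v, β v ≤ 1 := by
  obtain ⟨v₀, hv₀⟩ := hc
  intro v
  by_contra! hv
  have hreach := hd.preconnected ⟨v₀, (hb v₀ hv₀).1.ge⟩ ⟨v, hv.le⟩
  rw [SimpleGraph.reachable_iff_reflTransGen] at hreach
  have hα : ∀ w : {v : V | 1 ≤ β v},
      Relation.ReflTransGen (G.induce {v : V | 1 ≤ β v}).Adj ⟨v₀, (hb v₀ hv₀).1.ge⟩ w →
        α w = 1 := by
    intro w hw
    induction hw with
    | refl => exact hv₀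
    | @tail x y _ hxy ih =>
      have hy : 1 ≤ β y := y.2
      exact le_antisymm (ha y) (hy.trans_eq ((hb x ih).2 y hxy).symm)
  exact hv.ne' (hb v (hα _ hreach)).1
end
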